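/- arXiv:2405.19248 — 3 statements merged into one kernel-verified Lean document; each statement's English description precedes it below -/
import Mathlib

section
/- Let η, ν > 0, δ = η/ν, q ∈ ℕ, d ∈ ℕ, let e_{ij} > 0 and y_{ij} ∈ ℕ₀ for i = 1,…,d and j = 1,…,q, and write y_{•j} = Σ_i y_{ij}, e_{•j} = Σ_i e_{ij}. Then the (q+1)-fold integral ∫_0^∞ ∫_{(0,∞)^q} ∏_{j=1}^q ∏_{i=1}^d ((θ_j e_{ij})^{y_{ij}} / y_{ij}!) e^{-θ_j e_{ij}} · ∏_{j=1}^q g_{θ_0, δ}(θ_j) dθ_1 ⋯ dθ_q · g_{η,ν}(θ_0) dθ_0 equals (∏_{j=1}^q ∏_{i=1}^d (e_{ij})^{y_{ij}} / y_{ij}!) · ∫_0^∞ [δ^{q θ_0} ∏_{j=1}^q Γ(θ_0 + y_{•j}) / (Γ(θ_0)^q ∏_{j=1}^q (δ + e_{•j})^{θ_0 + y_{•j}})] g_{η,ν}(θ_0) dθ_0. -/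
open MeasureTheory Real Set Finset

/-- The Gamma density with shape `a > 0` and rate `k > 0`:
`g_{a,k}(θ) = (k^a / Γ(a)) θ^{a−1} e^{-kθ}` for `θ > 0`. -/
noncomputable def gammaPdf (a k θ : ℝ) : ℝ :=
  k ^ a / Real.Gamma a * θ ^ (a - 1) * Real.exp (-(k * θ))

/-- A product of Poisson weights with common latent rate `t`, integrated against a Gamma density. -/
theorem integral_poisson_prod_mul_gammaPdf {ι : Type*} [Fintype ι] {a k : ℝ} (ha : 0 < a)
    (hk : 0 < k) (e : ι → ℝ) (he : ∀ i, 0 ≤ e i) (y : ι → ℕ) :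
    ∫ t in Set.Ioi (0 : ℝ),
        (∏ i, (t * e i) ^ (y i) / ((y i).factorial : ℝ) * Real.exp (-(t * e i)))
          * gammaPdf a k t
      = (∏ i, (e i) ^ (y i) / ((y i).factorial : ℝ))
        * (k ^ a * Real.Gamma (a + ((∑ i, y i : ℕ) : ℝ))
          / (Real.Gamma a * (k + ∑ i, e i) ^ (a + ((∑ i, y i : ℕ) : ℝ)))) := by
  set Y : ℕ := ∑ i, y i
  set E : ℝ := ∑ i, e i
  have hkE : 0 < k + E := add_pos_of_pos_of_nonneg hk (Finset.sum_nonneg fun i _ => he i)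
  have haY : 0 < a + (Y : ℝ) := by positivity
  have integrand_eq : ∀ t ∈ Set.Ioi (0 : ℝ),
      (∏ i, (t * e i) ^ (y i) / ((y i).factorial : ℝ) * Real.exp (-(t * e i)))
          * gammaPdf a k t
        = ((∏ i, (e i) ^ (y i) / ((y i).factorial : ℝ)) * (k ^ a / Real.Gamma a))
          * (t ^ (a + (Y : ℝ) - 1) * Real.exp (-((k + E) * t))) := by
    intro t ht
    have weight_eq : ∏ i, (t * e i) ^ (y i) / ((y i).factorial : ℝ) * Real.exp (-(t * e i))
        = (∏ i, (e i) ^ (y i) / ((y i).factorial : ℝ)) * (t ^ Y * Real.exp (-(t * E))) := by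
      rw [← Finset.prod_pow_eq_pow_sum, Finset.mul_sum, ← Finset.sum_neg_distrib, Real.exp_sum,
        ← Finset.prod_mul_distrib, ← Finset.prod_mul_distrib]
      refine Finset.prod_congr rfl fun i _ => ?_
      rw [mul_pow]
      ring
    have rpow_eq : t ^ (a + (Y : ℝ) - 1) = t ^ (a - 1) * t ^ Y := by
      rw [← Real.rpow_natCast, ← Real.rpow_add ht]
      ring_nf
    have exp_eq : Real.exp (-((k + E) * t)) = Real.exp (-(k * t)) * Real.exp (-(t * E)) := by
      rw [← Real.exp_add]
      ring_nf
    rw [weight_eq, rpow_eq, exp_eq, gammaPdf]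
    ring
  rw [setIntegral_congr_fun measurableSet_Ioi integrand_eq, integral_const_mul,
    Real.integral_rpow_mul_exp_neg_mul_Ioi haY hkE, Real.div_rpow zero_le_one hkE.le,
    Real.one_rpow]
  ring

/-- The integral over a box of a product of functions of one coordinate. -/
theorem setIntegral_univ_pi_prod {ι : Type*} [Fintype ι] (s : ι → Set ℝ) (f : ι → ℝ → ℝ) :
    ∫ t in Set.univ.pi s, ∏ j, f j (t j) = ∏ j, ∫ x in s j, f j x := by
  rw [volume_pi, Measure.restrict_pi_pi, integral_fintype_prod_eq_prod]

/-- Joint pmf of the hierarchical Gamma mixed Poisson model: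
the `(q+1)`-fold integral of the conditional Poisson pmfs against the hierarchical
Gamma densities equals
`(∏_j ∏_i e_{ij}^{y_{ij}}/y_{ij}!) ∫_0^∞ δ^{qθ₀} ∏_j Γ(θ₀+y_{•j})
  / (Γ(θ₀)^q ∏_j (δ+e_{•j})^{θ₀+y_{•j}}) g_{η,ν}(θ₀) dθ₀`. -/
theorem hierarchical_gamma_mixed_poisson_pmf
    (η ν δ : ℝ) (hη : 0 < η) (hν : 0 < ν) (hδ : δ = η / ν)
    (q d : ℕ) (hq : 0 < q) (hd : 0 < d)
    (e : Fin d → Fin q → ℝ) (he : ∀ i j, 0 < e i j) (y : Fin d → Fin q → ℕ) :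
    (∫ θ₀ in Set.Ioi (0 : ℝ),
      (∫ t in Set.univ.pi (fun _ : Fin q => Set.Ioi (0 : ℝ)),
          (∏ j, ∏ i, (t j * e i j) ^ (y i j) / ((y i j).factorial : ℝ)
              * Real.exp (-(t j * e i j)))
            * ∏ j, gammaPdf θ₀ δ (t j))
        * gammaPdf η ν θ₀)
    = (∏ j, ∏ i, (e i j) ^ (y i j) / ((y i j).factorial : ℝ))
        * ∫ θ₀ in Set.Ioi (0 : ℝ),
            (δ ^ ((q : ℝ) * θ₀) * ∏ j, Real.Gamma (θ₀ + ((∑ i, y i j : ℕ) : ℝ)))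
              / (Real.Gamma θ₀ ^ q
                  * ∏ j, (δ + ∑ i, e i j) ^ (θ₀ + ((∑ i, y i j : ℕ) : ℝ)))
              * gammaPdf η ν θ₀ := by
  have hδ_pos : 0 < δ := hδ ▸ div_pos hη hν
  rw [← integral_const_mul]
  refine setIntegral_congr_fun measurableSet_Ioi fun θ₀ hθ₀ => ?_
  have hθ₀_pos : 0 < θ₀ := hθ₀
  simp only [← Finset.prod_mul_distrib]
  rw [setIntegral_univ_pi_prod (fun _ : Fin q => Set.Ioi (0 : ℝ)) fun j x =>
    (∏ i, (x * e i j) ^ (y i j) / ((y i j).factorial : ℝ) * Real.exp (-(x * e i j)))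
      * gammaPdf θ₀ δ x]
  simp only [fun j => integral_poisson_prod_mul_gammaPdf hθ₀_pos hδ_pos
    (fun i => e i j) (fun i => (he i j).le) (fun i => y i j)]
  rw [Finset.prod_mul_distrib, Finset.prod_div_distrib, Finset.prod_mul_distrib,
    Finset.prod_mul_distrib, Finset.prod_const, Finset.prod_const, Finset.card_univ,
    Fintype.card_fin, mul_comm (q : ℝ) θ₀, Real.rpow_mul_natCast hδ_pos.le]
  ring
end

section
/- Let η, ν > 0, δ = η/ν, q ∈ ℕ, let e_{•j} > 0 and y_{•j} ∈ ℕ₀ for j = 1,…,q, and define the joint posterior density on (0,∞)^{q+1} by π(θ_0, θ_1, …, θ_q) = [∏_{j=1}^q (θ_j)^{y_{•j}} e^{-θ_j e_{•j}} g_{θ_0,δ}(θ_j)] g_{η,ν}(θ_0) / Z, where Z is the normalizing constant making π integrate to one. Then for each j ∈ {1,…,q}: ∫_{(0,∞)^{q+1}} θ_j π(θ_0,…,θ_q) dθ_0 ⋯ dθ_q = ( y_{•j} + ∫_{(0,∞)^{q+1}} θ_0 π(θ_0,…,θ_q) dθ_0 ⋯ dθ_q ) / ( e_{•j} + η/ν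 ). That is, in the hierarchical Gamma model, E(Θ_j ∣ data) = ( y_{•j} + E(Θ_0 ∣ data) ) / ( e_{•j} + η/ν ). -/
open MeasureTheory Real Set Finset

/-- Unnormalized joint posterior density of `(Θ_0, Θ_1, …, Θ_q)` in the hierarchical
Gamma mixed Poisson model given group totals `y_{•j}` and exposures `e_{•j}`. -/
noncomputable def hierUnnormPost (η ν δ : ℝ) {q : ℕ} (ebar : Fin q → ℝ)
    (ybar : Fin q → ℕ) (θ₀ : ℝ) (t : Fin q → ℝ) : ℝ :=
  (∏ j, (t j) ^ (ybar j) * Real.exp (-(t j * ebar j)) * gammaPdf θ₀ δ (t j))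
    * gammaPdf η ν θ₀

/-- Up to the factor `n!` and a power of the exposure, the negative binomial probability of `n`
claims in the Gamma mixed Poisson model with shape `a`, rate `k` and exposure `e`. -/
noncomputable def gammaPoissonMarginal (a k e : ℝ) (n : ℕ) : ℝ :=
  k ^ a / Real.Gamma a * ((1 / (e + k)) ^ (a + n) * Real.Gamma (a + n))

lemma integral_pow_mul_exp_mul_gammaPdf {a k e : ℝ} (ha : 0 < a) (hk : 0 < k) (he : 0 < e)
    (n : ℕ) :
    ∫ t in Ioi (0 : ℝ), t ^ n * exp (-(t * e)) * gammaPdf a k t = gammaPoissonMarginal a k e n := by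
  have han : 0 < a + n := by positivity
  rw [gammaPoissonMarginal, ← Real.integral_rpow_mul_exp_neg_mul_Ioi han (add_pos he hk),
    ← integral_const_mul]
  refine setIntegral_congr_fun measurableSet_Ioi fun t ht => ?_
  have ht' : (0 : ℝ) < t := ht
  have h₁ : t ^ (a + n - 1) = t ^ n * t ^ (a - 1) := by
    rw [← rpow_natCast, ← rpow_add ht']
    ring_nf
  have h₂ : exp (-((e + k) * t)) = exp (-(t * e)) * exp (-(k * t)) := by
    rw [← Real.exp_add]
    ring_nf
  simp only [gammaPdf, h₁, h₂]
  ring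

lemma gammaPoissonMarginal_succ {a k e : ℝ} (ha : 0 < a) (hk : 0 < k) (he : 0 < e) (n : ℕ) :
    gammaPoissonMarginal a k e (n + 1) = (n + a) / (e + k) * gammaPoissonMarginal a k e n := by
  have han : 0 < a + n := by positivity
  have hek : 0 < 1 / (e + k) := by positivity
  rw [gammaPoissonMarginal, gammaPoissonMarginal, Nat.cast_succ, ← add_assoc,
    Real.Gamma_add_one han.ne', rpow_add hek, rpow_one]
  ring

lemma gammaPoissonMarginal_pos {a k e : ℝ} (ha : 0 < a) (hk : 0 < k) (he : 0 < e) (n : ℕ) :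
    0 < gammaPoissonMarginal a k e n := by
  have := Real.Gamma_pos_of_pos ha
  have := Real.Gamma_pos_of_pos (show 0 < a + n by positivity)
  unfold gammaPoissonMarginal
  positivity

lemma gammaPdf_pos {a k t : ℝ} (ha : 0 < a) (hk : 0 < k) (ht : 0 < t) : 0 < gammaPdf a k t := by
  have := Real.Gamma_pos_of_pos ha
  unfold gammaPdf
  positivity

/-- As a function of the shape, the marginal is a polynomial times a decaying exponential. -/
lemma exists_gammaPoissonMarginal_eq {k e : ℝ} (hk : 0 < k) (he : 0 < e) (n : ℕ) :
    ∃ p : Polynomial ℝ, ∀ a, 0 < a →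
      gammaPoissonMarginal a k e n = p.eval a * exp (-(log ((e + k) / k) * a)) := by
  induction n with
  | zero =>
    refine ⟨1, fun a ha => ?_⟩
    have hek : 0 < e + k := by positivity
    have := (Real.Gamma_pos_of_pos ha).ne'
    rw [gammaPoissonMarginal, ← neg_mul, ← log_inv, ← rpow_def_of_pos (by positivity), inv_div,
      div_rpow hk.le hek.le, div_rpow zero_le_one hek.le]
    simp
    field_simp
  | succ n ih =>
    obtain ⟨p, hp⟩ := ih
    refine ⟨Polynomial.C (1 / (e + k)) * (Polynomial.C (n : ℝ) + Polynomial.X) * p,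
      fun a ha => ?_⟩
    rw [gammaPoissonMarginal_succ ha hk he, hp a ha]
    simp only [Polynomial.eval_mul, Polynomial.eval_add, Polynomial.eval_C, Polynomial.eval_X]
    ring

lemma integrableOn_eval_mul_rpow_mul_exp {s c : ℝ} (hs : 0 < s) (hc : 0 < c) (p : Polynomial ℝ) :
    IntegrableOn (fun x : ℝ => p.eval x * (x ^ (s - 1) * exp (-(c * x)))) (Ioi 0) := by
  induction p using Polynomial.induction_on' with
  | add p q hp hq =>
    simp only [Polynomial.eval_add, add_mul]
    exact hp.add hq
  | monomial n b =>
    have h := (integrableOn_rpow_mul_exp_neg_mul_rpow (p := 1) (s := n + s - 1) (b := c)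
      (by linarith [n.cast_nonneg (α := ℝ)]) one_pos hc).const_mul b
    refine IntegrableOn.congr_fun h (fun x hx => ?_) measurableSet_Ioi
    have hx' : (0 : ℝ) < x := hx
    have : x ^ ((n : ℝ) + s - 1) = x ^ n * x ^ (s - 1) := by
      rw [← rpow_natCast, ← rpow_add hx']
      ring_nf
    simp only [this, rpow_one, Polynomial.eval_monomial, neg_mul]
    ring

lemma exists_prod_gammaPoissonMarginal_eq {ι : Type*} {k : ℝ} (hk : 0 < k) {e : ι → ℝ}
    (he : ∀ i, 0 < e i) (n : ι → ℕ) (s : Finset ι) :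
    ∃ p : Polynomial ℝ, ∃ c : ℝ, 0 ≤ c ∧ ∀ a, 0 < a →
      ∏ i ∈ s, gammaPoissonMarginal a k (e i) (n i) = p.eval a * exp (-(c * a)) := by
  choose p hp using fun i => exists_gammaPoissonMarginal_eq hk (he i) (n i)
  refine ⟨∏ i ∈ s, p i, ∑ i ∈ s, log ((e i + k) / k), sum_nonneg fun i _ => log_nonneg ?_,
    fun a ha => ?_⟩
  · rw [one_le_div hk]
    linarith [he i]
  · rw [prod_congr rfl fun i _ => hp i a ha, prod_mul_distrib, Polynomial.eval_prod, sum_mul,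
      ← sum_neg_distrib, Real.exp_sum]

lemma integrableOn_eval_mul_prod_gammaPoissonMarginal_mul_gammaPdf {ι : Type*} {η ν k : ℝ}
    (hη : 0 < η) (hν : 0 < ν) (hk : 0 < k) {e : ι → ℝ} (he : ∀ i, 0 < e i) (n : ι → ℕ)
    (s : Finset ι) (r : Polynomial ℝ) :
    IntegrableOn (fun a : ℝ => r.eval a *
      ((∏ i ∈ s, gammaPoissonMarginal a k (e i) (n i)) * gammaPdf η ν a)) (Ioi 0) := by
  obtain ⟨p, c, hc, hp⟩ := exists_prod_gammaPoissonMarginal_eq hk he n s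
  refine IntegrableOn.congr_fun ((integrableOn_eval_mul_rpow_mul_exp hη (add_pos_of_pos_of_nonneg
    hν hc) (r * p)).const_mul (ν ^ η / Real.Gamma η)) (fun a ha => ?_) measurableSet_Ioi
  have h : exp (-((ν + c) * a)) = exp (-(ν * a)) * exp (-(c * a)) := by
    rw [← Real.exp_add]
    ring_nf
  simp only [hp a ha, gammaPdf, h, Polynomial.eval_mul]
  ring

lemma setIntegral_pi_prod {ι : Type*} [Fintype ι] (s : ι → Set ℝ) (f : ι → ℝ → ℝ) :
    ∫ t in Set.univ.pi s, ∏ i, f i (t i) = ∏ i, ∫ x in s i, f i x := by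
  rw [volume_pi, Measure.restrict_pi_pi, integral_fintype_prod_eq_prod]

section Conditional

variable {η ν δ θ₀ : ℝ} {q : ℕ} {ebar : Fin q → ℝ}

lemma integral_hierUnnormPost (hδ : 0 < δ) (he : ∀ i, 0 < ebar i) (ybar : Fin q → ℕ)
    (hθ : 0 < θ₀) :
    ∫ t in Set.univ.pi (fun _ : Fin q => Ioi (0 : ℝ)), hierUnnormPost η ν δ ebar ybar θ₀ t
      = (∏ i, gammaPoissonMarginal θ₀ δ (ebar i) (ybar i)) * gammaPdf η ν θ₀ := by
  simp only [hierUnnormPost]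
  rw [integral_mul_const, setIntegral_pi_prod (fun _ => Ioi (0 : ℝ))
    (fun i x => x ^ ybar i * exp (-(x * ebar i)) * gammaPdf θ₀ δ x)]
  simp only [integral_pow_mul_exp_mul_gammaPdf hθ hδ (he _)]

/-- The credibility formula conditionally on `Θ₀ = θ₀`. -/
lemma integral_coord_mul_hierUnnormPost (hδ : 0 < δ) (he : ∀ i, 0 < ebar i) (ybar : Fin q → ℕ)
    (hθ : 0 < θ₀) (j : Fin q) :
    ∫ t in Set.univ.pi (fun _ : Fin q => Ioi (0 : ℝ)), t j * hierUnnormPost η ν δ ebar ybar θ₀ t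
      = (ybar j + θ₀) / (ebar j + δ) *
        ((∏ i, gammaPoissonMarginal θ₀ δ (ebar i) (ybar i)) * gammaPdf η ν θ₀) := by
  have h (t : Fin q → ℝ) : t j * hierUnnormPost η ν δ ebar ybar θ₀ t
      = hierUnnormPost η ν δ ebar (fun i => ybar i + if i = j then 1 else 0) θ₀ t := by
    simp only [hierUnnormPost, pow_add, prod_mul_distrib]
    simp
    ring
  simp only [h]
  rw [integral_hierUnnormPost hδ he _ hθ, ← mul_assoc]
  congr 1
  rw [← mul_prod_erase _ _ (mem_univ j), ← mul_prod_erase univ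
    (fun i => gammaPoissonMarginal θ₀ δ (ebar i) (ybar i)) (mem_univ j), ← mul_assoc, if_pos rfl,
    gammaPoissonMarginal_succ hθ hδ (he j)]
  congr 1
  refine prod_congr rfl fun i hi => ?_
  rw [if_neg (ne_of_mem_erase hi), add_zero]

end Conditional

/-- In the hierarchical Gamma model, with `π = hierUnnormPost / Z` the
normalized joint posterior density on `(0,∞)^{q+1}`, the posterior means satisfy, for
each `j`, `E(Θ_j ∣ data) = (y_{•j} + E(Θ_0 ∣ data)) / (e_{•j} + η/ν)`. -/
theorem hierarchical_gamma_posterior_mean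
    (η ν δ : ℝ) (hη : 0 < η) (hν : 0 < ν) (hδ : δ = η / ν)
    (q : ℕ) (hq : 0 < q) (ebar : Fin q → ℝ) (he : ∀ j, 0 < ebar j)
    (ybar : Fin q → ℕ)
    (Z : ℝ)
    (hZ : Z = ∫ θ₀ in Set.Ioi (0 : ℝ),
        ∫ t in Set.univ.pi (fun _ : Fin q => Set.Ioi (0 : ℝ)),
          hierUnnormPost η ν δ ebar ybar θ₀ t)
    (j : Fin q) :
    (∫ θ₀ in Set.Ioi (0 : ℝ),
        ∫ t in Set.univ.pi (fun _ : Fin q => Set.Ioi (0 : ℝ)),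
          t j * hierUnnormPost η ν δ ebar ybar θ₀ t / Z)
      = ((ybar j : ℝ)
          + ∫ θ₀ in Set.Ioi (0 : ℝ),
              ∫ t in Set.univ.pi (fun _ : Fin q => Set.Ioi (0 : ℝ)),
                θ₀ * hierUnnormPost η ν δ ebar ybar θ₀ t / Z)
        / (ebar j + η / ν) := by
  have hδ₀ : 0 < δ := hδ ▸ div_pos hη hν
  rw [← hδ]
  set F : ℝ → ℝ := fun θ =>
    (∏ i, gammaPoissonMarginal θ δ (ebar i) (ybar i)) * gammaPdf η ν θ with hF
  have hF_pos : ∀ θ ∈ Ioi (0 : ℝ), 0 < F θ := fun θ hθ =>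
    mul_pos (prod_pos fun i _ => gammaPoissonMarginal_pos hθ hδ₀ (he i) _) (gammaPdf_pos hη hν hθ)
  have hF_supp : Set.Ioi 0 ⊆ Function.support F := fun θ hθ => (hF_pos θ hθ).ne'
  have hF_int (r : Polynomial ℝ) : IntegrableOn (fun θ => r.eval θ * F θ) (Ioi 0) :=
    integrableOn_eval_mul_prod_gammaPoissonMarginal_mul_gammaPdf hη hν hδ₀ he ybar univ r
  have hF_int₀ : IntegrableOn F (Ioi 0) := by simpa using hF_int 1
  have hF_int₁ : IntegrableOn (fun θ => θ * F θ) (Ioi 0) := by simpa using hF_int Polynomial.X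
  have hZF : Z = ∫ θ in Ioi (0 : ℝ), F θ :=
    hZ.trans (setIntegral_congr_fun measurableSet_Ioi fun θ hθ =>
      integral_hierUnnormPost hδ₀ he ybar hθ)
  have hZ_pos : 0 < Z := by
    rw [hZF, setIntegral_pos_iff_support_of_nonneg_ae
      ((ae_restrict_iff' measurableSet_Ioi).2 (.of_forall fun θ hθ => (hF_pos θ hθ).le)) hF_int₀,
      Set.inter_eq_right.2 hF_supp]
    simp
  have hL : ∫ θ in Ioi (0 : ℝ), ∫ t in Set.univ.pi (fun _ : Fin q => Ioi (0 : ℝ)),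
      t j * hierUnnormPost η ν δ ebar ybar θ t / Z
      = ∫ θ in Ioi (0 : ℝ), (ybar j * F θ + θ * F θ) / ((ebar j + δ) * Z) := by
    refine setIntegral_congr_fun measurableSet_Ioi fun θ hθ => ?_
    simp only [integral_div, integral_coord_mul_hierUnnormPost hδ₀ he ybar hθ j, hF]
    field_simp
  have hR : ∫ θ in Ioi (0 : ℝ), ∫ t in Set.univ.pi (fun _ : Fin q => Ioi (0 : ℝ)),
      θ * hierUnnormPost η ν δ ebar ybar θ t / Z = ∫ θ in Ioi (0 : ℝ), θ * F θ / Z := by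
    refine setIntegral_congr_fun measurableSet_Ioi fun θ hθ => ?_
    simp only [integral_div, integral_const_mul, integral_hierUnnormPost hδ₀ he ybar hθ, hF]
  have hej : 0 < ebar j + δ := add_pos (he j) hδ₀
  rw [hL, hR, integral_div, integral_div, integral_add (hF_int₀.const_mul _) hF_int₁,
    integral_const_mul, ← hZF]
  field_simp
end

section
/- Let T be a p × p real matrix all of whose complex eigenvalues have negative real part, let u ≥ 0, and let n ∈ ℕ₀. Then ∫_0^∞ θ^n e^{-uθ} e^{Tθ} dθ = n! · (uI − T)^{-(n+1)}, where e^{Tθ} denotes the matrix exponential and the integral is a convergent Bochner integral of matrix-valued functions. -/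
open MeasureTheory Real Set Matrix

/-- The matrix exponential `e^M = Σ_{r ≥ 0} M^r / r!`. -/
noncomputable def matExp {p : ℕ} (M : Matrix (Fin p) (Fin p) ℝ) :
    Matrix (Fin p) (Fin p) ℝ :=
  ∑' r : ℕ, ((r.factorial : ℝ)⁻¹) • M ^ r

theorem integrableOn_pow_mul_cexp (m : ℕ) {c : ℂ} (hc : c.re < 0) :
    IntegrableOn (fun θ : ℝ => (θ : ℂ) ^ m * Complex.exp (θ * c)) (Ioi 0) := by
  have h := integrableOn_rpow_mul_exp_neg_mul_rpow (s := m) (p := 1) (b := -c.re)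
    (by have : (0:ℝ) ≤ m := m.cast_nonneg
        linarith) zero_lt_one (by linarith)
  refine Integrable.mono' h (by fun_prop) ?_
  filter_upwards [ae_restrict_mem measurableSet_Ioi] with θ hθ
  have hθ : 0 < θ := hθ
  simp [Complex.norm_exp, abs_of_pos hθ, mul_comm]

section
open scoped Matrix.Norms.Operator
variable {ι : Type*} [Fintype ι] [DecidableEq ι]

theorem hasSum_exp_mulVec (N : Matrix ι ι ℂ) (v : ι → ℂ) :
    HasSum (fun k : ℕ => ((k.factorial : ℂ)⁻¹) • (N ^ k *ᵥ v)) (NormedSpace.exp N *ᵥ v) := by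
  have h := NormedSpace.exp_series_hasSum_exp' (𝕂 := ℂ) N
  have hv : Continuous (fun M : Matrix ι ι ℂ => M *ᵥ v) := by fun_prop
  simpa [Function.comp_def, Matrix.smul_mulVec] using! h.map
    (AddMonoidHom.mk' (fun M : Matrix ι ι ℂ => M *ᵥ v) fun A B => Matrix.add_mulVec A B v) hv

theorem exp_smul_eq_smul_exp_smul_sub {𝕜 : Type*} [RCLike 𝕜] (A : Matrix ι ι 𝕜) (t c : 𝕜) :
    NormedSpace.exp (t • A) = NormedSpace.exp (t * c) • NormedSpace.exp (t • (A - c • 1)) := by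
  have h1 : t • A = algebraMap 𝕜 _ (t * c) + t • (A - c • 1) := by
    rw [Algebra.algebraMap_eq_smul_one, smul_sub, smul_smul]; abel
  have h2 : NormedSpace.exp (algebraMap 𝕜 (Matrix ι ι 𝕜) (t * c)) =
      algebraMap 𝕜 _ (NormedSpace.exp (t * c)) := (NormedSpace.algebraMap_exp_comm _).symm
  rw [h1, Matrix.exp_add_of_commute _ _ (Algebra.commute_algebraMap_left _ _),
    h2, Algebra.algebraMap_eq_smul_one, smul_one_mul]

theorem hasDerivAt_exp_smul_apply (B : Matrix ι ι ℝ) (i j : ι) (t : ℝ) :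
    HasDerivAt (fun θ : ℝ => NormedSpace.exp (θ • B) i j) ((B * NormedSpace.exp (t • B)) i j) t :=
  ((LinearMap.toContinuousLinearMap (Matrix.entryLinearMap ℝ ℝ i j)).hasFDerivAt).comp_hasDerivAt t
    (hasDerivAt_exp_smul_const' B t)

theorem ofReal_exp_apply (B : Matrix ι ι ℝ) (i j : ι) :
   ((NormedSpace.exp B i j : ℝ) : ℂ) = NormedSpace.exp (B.map Complex.ofReal) i j := by
  have := NormedSpace.map_exp (Complex.ofRealHom.mapMatrix (m := ι)) (by
    show Continuous (fun M : Matrix ι ι ℝ => M.map Complex.ofReal)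
    fun_prop) B
  exact congrFun (congrFun this i) j

theorem exp_smul_mulVec_eq_sum (A : Matrix ι ι ℂ) (c t : ℂ) {v : ι → ℂ} {K : ℕ}
    (hv : (A - c • 1) ^ K *ᵥ v = 0) :
    NormedSpace.exp (t • A) *ᵥ v = ∑ k ∈ Finset.range K,
      (t ^ k * Complex.exp (t * c)) • (((k.factorial : ℂ)⁻¹) • ((A - c • 1) ^ k *ᵥ v)) := by
  have h := (hasSum_exp_mulVec (t • (A - c • 1)) v).unique
    (hasSum_sum_of_ne_finset_zero (s := Finset.range K) ?_)
  · rw [exp_smul_eq_smul_exp_smul_sub A t c, ← Complex.exp_eq_exp_ℂ, Matrix.smul_mulVec, h,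
      Finset.smul_sum]
    refine Finset.sum_congr rfl fun k _ => ?_
    rw [smul_pow, Matrix.smul_mulVec]
    simp only [smul_smul]
    congr 1; ring
  · intro k hk
    obtain ⟨l, rfl⟩ := Nat.exists_eq_add_of_le (not_lt.mp (Finset.mem_range.not.mp hk))
    rw [add_comm, smul_pow, pow_add (A - c • 1), Matrix.smul_mulVec, ← Matrix.mulVec_mulVec, hv]
    simp

theorem integrableOn_pow_mul_exp_smul_mulVec (A : Matrix ι ι ℂ)
    (hA : ∀ z ∈ spectrum ℂ A, z.re < 0) (n : ℕ) (v : ι → ℂ) (i : ι) :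
    IntegrableOn (fun θ : ℝ => (θ : ℂ) ^ n * (NormedSpace.exp ((θ : ℂ) • A) *ᵥ v) i) (Ioi 0) := by
  have hv : v ∈ ⨆ μ, Module.End.maxGenEigenspace (Matrix.toLin' A) μ := by
    rw [Module.End.iSup_maxGenEigenspace_eq_top]; trivial
  induction hv using Submodule.iSup_induction' with
  | zero => simp
  | add x y _ _ hx hy => simpa [Matrix.mulVec_add, mul_add] using! hx.add hy
  | mem μ x hx =>
    obtain ⟨K, hK⟩ := (Module.End.mem_maxGenEigenspace _ _ _).1 hx
    by_cases hx0 : x = 0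
    · simp [hx0]
    have hμ : μ ∈ spectrum ℂ A := by
      rw [← Matrix.spectrum_toLin']
      refine (Module.End.hasEigenvalue_of_hasGenEigenvalue (k := K) ?_).mem_spectrum
      intro h
      exact hx0 ((Submodule.eq_bot_iff _).1 h x (Module.End.mem_genEigenspace_nat.2 hK))
    have hK' : (A - μ • 1) ^ K *ᵥ x = 0 := by
      rwa [Module.End.one_eq_id, ← Matrix.toLin'_one, ← map_smul, ← map_sub, ← Matrix.toLin'_pow,
        Matrix.toLin'_apply] at hK
    simp only [exp_smul_mulVec_eq_sum A μ _ hK', Finset.sum_apply, Finset.mul_sum, Pi.smul_apply,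
      smul_eq_mul]
    refine integrable_finsetSum _ fun k _ => ?_
    refine ((integrableOn_pow_mul_cexp (n + k) (hA μ hμ)).mul_const
      ((k.factorial : ℂ)⁻¹ * ((A - μ • 1) ^ k *ᵥ x) i)).congr ?_
    exact Filter.Eventually.of_forall fun θ => by ring

theorem integrableOn_pow_mul_exp_smul_apply (B : Matrix ι ι ℝ)
    (hB : ∀ z ∈ spectrum ℂ (B.map Complex.ofReal), z.re < 0) (n : ℕ) (i j : ι) :
    IntegrableOn (fun θ : ℝ => θ ^ n * NormedSpace.exp (θ • B) i j) (Ioi 0) := by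
  have h := (integrableOn_pow_mul_exp_smul_mulVec _ hB n (Pi.single j 1) i).re
  refine h.congr (Filter.Eventually.of_forall fun θ => ?_)
  have hmap : (θ : ℂ) • B.map Complex.ofReal = (θ • B).map Complex.ofReal := by
    ext; simp
  simp only [hmap, Matrix.mulVec_single_one, Matrix.col_apply, ← ofReal_exp_apply]
  norm_cast

theorem mul_integral_exp_smul (B : Matrix ι ι ℝ)
    (hB : ∀ z ∈ spectrum ℂ (B.map Complex.ofReal), z.re < 0) :
    -B * Matrix.of (fun i j => ∫ θ in Ioi (0 : ℝ), NormedSpace.exp (θ • B) i j) = 1 := by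
  have hint := fun i j => by simpa using integrableOn_pow_mul_exp_smul_apply B hB 0 i j
  ext i j
  have hd' : IntegrableOn (fun θ : ℝ => (B * NormedSpace.exp (θ • B)) i j) (Ioi 0) := by
    simp only [Matrix.mul_apply]
    exact integrable_finsetSum _ fun k _ => (hint k j).const_mul _
  have h := integral_Ioi_of_hasDerivAt_of_tendsto' (a := 0)
    (fun t _ => hasDerivAt_exp_smul_apply B i j t) hd'
    (tendsto_zero_of_hasDerivAt_of_integrableOn_Ioi
      (fun t _ => hasDerivAt_exp_smul_apply B i j t) hd' (hint i j))
  simp only [Matrix.mul_apply] at h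
  rw [integral_finsetSum _ fun k _ => (hint k j).const_mul _] at h
  simp only [integral_const_mul, zero_smul, NormedSpace.exp_zero, zero_sub] at h
  simp [Matrix.mul_apply, h]

theorem mul_integral_pow_mul_exp_smul_succ (B : Matrix ι ι ℝ)
    (hB : ∀ z ∈ spectrum ℂ (B.map Complex.ofReal), z.re < 0) (n : ℕ) :
    -B * Matrix.of (fun i j => ∫ θ in Ioi (0 : ℝ), θ ^ (n + 1) * NormedSpace.exp (θ • B) i j) =
      ((n : ℝ) + 1) •
        Matrix.of (fun i j => ∫ θ in Ioi (0 : ℝ), θ ^ n * NormedSpace.exp (θ • B) i j) := by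
  have hint := integrableOn_pow_mul_exp_smul_apply B hB
  ext i j
  have hderiv (t : ℝ) : HasDerivAt (fun θ : ℝ => θ ^ (n + 1) * NormedSpace.exp (θ • B) i j)
      ((n + 1) * (t ^ n * NormedSpace.exp (t • B) i j) +
        ∑ k, B i k * (t ^ (n + 1) * NormedSpace.exp (t • B) k j)) t := by
    convert! (hasDerivAt_pow (n + 1) t).mul (hasDerivAt_exp_smul_apply B i j t) using 1
    simp only [Matrix.mul_apply, Finset.mul_sum, Nat.cast_add, Nat.cast_one, Nat.add_sub_cancel,
      mul_assoc, mul_left_comm (B i _)]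
  have h₁ := (hint n i j).const_mul ((n : ℝ) + 1)
  have h₂ := fun k (_ : k ∈ Finset.univ) => (hint (n + 1) k j).const_mul (B i k)
  have hd' := h₁.add (integrable_finsetSum _ h₂)
  have h := integral_Ioi_of_hasDerivAt_of_tendsto' (a := 0) (fun t _ => hderiv t) hd'
    (tendsto_zero_of_hasDerivAt_of_integrableOn_Ioi (fun t _ => hderiv t) hd' (hint (n + 1) i j))
  rw [integral_add h₁ (integrable_finsetSum _ h₂), integral_finsetSum _ h₂] at h
  simp only [integral_const_mul, ne_eq, Nat.add_eq_zero_iff, one_ne_zero, and_false,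
    not_false_eq_true, zero_pow, zero_mul, sub_zero] at h
  simp only [Matrix.mul_apply, Matrix.neg_apply, Matrix.of_apply, Matrix.smul_apply, smul_eq_mul,
    neg_mul, Finset.sum_neg_distrib]
  linarith

theorem integral_pow_mul_exp_smul (B : Matrix ι ι ℝ)
    (hB : ∀ z ∈ spectrum ℂ (B.map Complex.ofReal), z.re < 0) (n : ℕ) :
    Matrix.of (fun i j => ∫ θ in Ioi (0 : ℝ), θ ^ n * NormedSpace.exp (θ • B) i j) =
      (n.factorial : ℝ) • (-B)⁻¹ ^ (n + 1) := by
  have h₀ := mul_integral_exp_smul B hB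
  have hdet : IsUnit (-B).det := (Matrix.isUnit_iff_isUnit_det _).1 (.of_mul_eq_one _ h₀)
  induction n with
  | zero => simpa using (Matrix.inv_eq_right_inv h₀).symm
  | succ n ih =>
    have h := congrArg ((-B)⁻¹ * ·) (mul_integral_pow_mul_exp_smul_succ B hB n)
    simp only [Matrix.nonsing_inv_mul_cancel_left _ _ hdet] at h
    rw [h, ih, smul_smul, Matrix.mul_smul, ← pow_succ', Nat.factorial_succ]
    push_cast
    rfl

end

theorem matExp_eq_exp {p : ℕ} (M : Matrix (Fin p) (Fin p) ℝ) : matExp M = NormedSpace.exp M := by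
  rw [NormedSpace.exp_eq_tsum ℝ]
  rfl

theorem exp_neg_mul_mul_matExp_smul_apply {p : ℕ} (T : Matrix (Fin p) (Fin p) ℝ) (u θ : ℝ)
    (i j : Fin p) :
    Real.exp (-(u * θ)) * matExp (θ • T) i j = NormedSpace.exp (θ • (T - u • 1)) i j := by
  have hexp : NormedSpace.exp (θ • (T - u • 1)) =
      Real.exp (-(u * θ)) • NormedSpace.exp (θ • T) := by
    rw [exp_smul_eq_smul_exp_smul_sub T θ u, smul_smul, ← Real.exp_eq_exp_ℝ, ← Real.exp_add]
    simp [mul_comm u]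
  rw [matExp_eq_exp, hexp, Matrix.smul_apply, smul_eq_mul]

/-- Let `T` be a `p × p` real matrix all of whose complex eigenvalues
have negative real part, `u ≥ 0`, `n ∈ ℕ₀`. Then (entrywise, as convergent integrals)
`∫_0^∞ θ^n e^{-uθ} e^{Tθ} dθ = n! (uI − T)^{-(n+1)}`. -/
theorem subintensity_moment_resolvent
    (p : ℕ) (T : Matrix (Fin p) (Fin p) ℝ)
    (hT : ∀ z ∈ spectrum ℂ (T.map Complex.ofReal), z.re < 0)
    (u : ℝ) (hu : 0 ≤ u) (n : ℕ) :
    (∀ i j, IntegrableOn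
        (fun θ : ℝ => θ ^ n * Real.exp (-(u * θ)) * matExp (θ • T) i j)
        (Set.Ioi 0)) ∧
    (∀ i j, ∫ θ in Set.Ioi (0 : ℝ), θ ^ n * Real.exp (-(u * θ)) * matExp (θ • T) i j
        = ((n.factorial : ℝ)
            • ((u • (1 : Matrix (Fin p) (Fin p) ℝ) - T)⁻¹ ^ (n + 1))) i j) := by
  have hB : ∀ z ∈ spectrum ℂ ((T - u • 1).map Complex.ofReal), z.re < 0 := by
    intro z hz
    have hmap : (T - u • 1).map Complex.ofReal =
        T.map Complex.ofReal - algebraMap ℂ (Matrix (Fin p) (Fin p) ℂ) u := by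
      ext i j
      by_cases h : i = j <;> simp [Matrix.algebraMap_matrix_apply, h]
    rw [hmap, ← spectrum.sub_singleton_eq] at hz
    obtain ⟨w, hw, _, rfl, rfl⟩ := hz
    have := hT w hw
    simp only [Complex.sub_re, Complex.ofReal_re]
    linarith
  simp only [mul_assoc, exp_neg_mul_mul_matExp_smul_apply]
  refine ⟨integrableOn_pow_mul_exp_smul_apply _ hB n, fun i j => ?_⟩
  rw [← neg_sub T, ← integral_pow_mul_exp_smul _ hB n, Matrix.of_apply]
end
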